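/- arXiv:2404.12520 — 4 statements merged into one kernel-verified Lean document; each statement's English description precedes it below -/
import Mathlib

section
/- Let (Ω, μ) be a probability space, F and E measurable spaces, and Y : Ω → F, X : Ω → E independent random variables. Let f : F → ℝᵈ be measurable (the actor policy gradient) and ĥ : F × E → ℝ measurable (the derivative of the centralized critic with respect to the agent's own action), such that the ℝᵈ-valued random vector ĥ(Y, X)·f(Y) is integrable and, for each y ∈ F, x ↦ ĥ(y, x) is integrable against the law of X. Define the decentralized critic derivative h : F → ℝ by h(y) = E[ĥ(y, X)]. Then the expected decentralized policy gradient equals the expected centralized policy gradient: E[h(Y)·f(Y)] = E[ĥ(Y, X)·f(Y)] in ℝᵈ. -/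
open MeasureTheory

/-- Theorem 1: the expected decentralized (I-DDPG) policy gradient equals the
expected centralized (CTDE-DDPG) policy gradient:
`E[h(Y) • f(Y)] = E[ĥ(Y, X) • f(Y)]` in `ℝᵈ`, where `h(y) = E[ĥ(y, X)]`. -/
theorem expected_decentralized_policy_gradient_eq_centralized
    {Ω F E : Type*} [MeasurableSpace Ω] [MeasurableSpace F] [MeasurableSpace E]
    (μ : Measure Ω) [IsProbabilityMeasure μ]
    (Y : Ω → F) (X : Ω → E) (hY : Measurable Y) (hX : Measurable X)
    (hindep : ProbabilityTheory.IndepFun Y X μ)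
    (d : ℕ) (f : F → EuclideanSpace ℝ (Fin d)) (hf : Measurable f)
    (hhat : F × E → ℝ) (hhat_meas : Measurable hhat)
    (hint_c : Integrable (fun ω => hhat (Y ω, X ω) • f (Y ω)) μ)
    (hint_x : ∀ y : F, Integrable (fun x => hhat (y, x)) (μ.map X))
    (h : F → ℝ) (hdef : ∀ y : F, h y = ∫ x, hhat (y, x) ∂(μ.map X)) :
    ∫ ω, h (Y ω) • f (Y ω) ∂μ = ∫ ω, hhat (Y ω, X ω) • f (Y ω) ∂μ := by
  have : IsProbabilityMeasure (μ.map X) := Measure.isProbabilityMeasure_map hX.aemeasurable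
  have hmap : μ.map (fun ω => (Y ω, X ω)) = (μ.map Y).prod (μ.map X) :=
    hindep.map_prod_eq_prod_map_map hY.aemeasurable hX.aemeasurable
  have hYX : Measurable fun ω => (Y ω, X ω) := hY.prodMk hX
  have hg : Measurable fun p : F × E => hhat p • f p.1 :=
    hhat_meas.smul (hf.comp measurable_fst)
  have hg_int : Integrable (fun p : F × E => hhat p • f p.1) ((μ.map Y).prod (μ.map X)) := by
    rw [← hmap]
    exact (integrable_map_measure hg.aestronglyMeasurable hYX.aemeasurable).2 hint_c
  have hh : Measurable h := by
    rw [funext hdef]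
    exact hhat_meas.stronglyMeasurable.integral_prod_right'.measurable
  calc
    ∫ ω, h (Y ω) • f (Y ω) ∂μ = ∫ y, h y • f y ∂(μ.map Y) :=
      (integral_map hY.aemeasurable (hh.smul hf).aestronglyMeasurable).symm
    _ = ∫ y, ∫ x, hhat (y, x) • f y ∂(μ.map X) ∂(μ.map Y) := by
      simp_rw [hdef, integral_smul_const]
    _ = ∫ p, hhat p • f p.1 ∂((μ.map Y).prod (μ.map X)) := (integral_prod _ hg_int).symm
    _ = ∫ ω, hhat (Y ω, X ω) • f (Y ω) ∂μ := by
      rw [← hmap]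
      exact integral_map hYX.aemeasurable hg.aestronglyMeasurable
end

section
/- Let (Ω, μ) be a probability space, F and E measurable spaces, and Y : Ω → F, X : Ω → E independent random variables. Let f : F → ℝᵈ and ĥ : F × E → ℝ be measurable with all the second moments below finite. Define h : F → ℝ by h(y) = E[ĥ(y, X)], and set g_c = ĥ(Y, X)·f(Y) and g_d = h(Y)·f(Y). Then for all indices j, k ∈ {1, …, d}, E[(g_c)_j (g_c)_k] − E[(g_d)_j (g_d)_k] = E[ f_j(Y) f_k(Y) · ( E[ĥ(Y, X)² | Y] − h(Y)² ) ], i.e., the difference of the second-moment matrices of the centralized and decentralized policy gradients equals the expectation of the outer product f(Y)f(Y)ᵀ weighted by the conditional variance of ĥ(Y, ·) given Y. -/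
open MeasureTheory

/-- The expectation of a function of two independent random variables, computed by first
integrating out the second variable. -/
theorem ProbabilityTheory.IndepFun.integral_comp_prodMk {Ω F E G : Type*} [MeasurableSpace Ω]
    [MeasurableSpace F] [MeasurableSpace E] [NormedAddCommGroup G] [NormedSpace ℝ G]
    {μ : Measure Ω} [IsFiniteMeasure μ] {Y : Ω → F} {X : Ω → E}
    (hindep : ProbabilityTheory.IndepFun Y X μ) (hY : Measurable Y) (hX : Measurable X)
    {g : F × E → G} (hg : StronglyMeasurable g)
    (hint : Integrable (fun ω => g (Y ω, X ω)) μ) :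
    ∫ ω, g (Y ω, X ω) ∂μ = ∫ ω, ∫ x, g (Y ω, x) ∂(μ.map X) ∂μ := by
  have hmap := (ProbabilityTheory.indepFun_iff_map_prod_eq_prod_map_map
    hY.aemeasurable hX.aemeasurable).1 hindep
  have hYX : AEMeasurable (fun ω => (Y ω, X ω)) μ := (hY.prodMk hX).aemeasurable
  have hint' : Integrable g ((μ.map Y).prod (μ.map X)) := by
    rw [← hmap]
    exact (integrable_map_measure hg.aestronglyMeasurable hYX).2 hint
  rw [← integral_map hYX hg.aestronglyMeasurable, hmap, integral_prod _ hint',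
    integral_map hY.aemeasurable hg.integral_prod_right'.aestronglyMeasurable]

/-- The second-moment identity of Theorem 2's proof: for all components `j, k`,
`E[(g_c)_j (g_c)_k] − E[(g_d)_j (g_d)_k]
  = E[f_j(Y) f_k(Y) (E[ĥ(Y,X)² | Y] − h(Y)²)]`,
where (by independence of `Y` and `X`) `E[ĥ(Y,X)² | Y] = v(Y)` with
`v(y) = E[ĥ(y,X)²]`, `h(y) = E[ĥ(y,X)]`, `g_c = ĥ(Y,X) • f(Y)` and
`g_d = h(Y) • f(Y)`. -/
theorem second_moment_difference_eq_conditional_variance_weighted_outer_product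
    {Ω F E : Type*} [MeasurableSpace Ω] [MeasurableSpace F] [MeasurableSpace E]
    (μ : Measure Ω) [IsProbabilityMeasure μ]
    (Y : Ω → F) (X : Ω → E) (hY : Measurable Y) (hX : Measurable X)
    (hindep : ProbabilityTheory.IndepFun Y X μ)
    (d : ℕ) (f : F → EuclideanSpace ℝ (Fin d)) (hf : Measurable f)
    (hhat : F × E → ℝ) (hhat_meas : Measurable hhat)
    (hint_x : ∀ y : F, Integrable (fun x => hhat (y, x)) (μ.map X))
    (hint_x2 : ∀ y : F, Integrable (fun x => (hhat (y, x)) ^ 2) (μ.map X))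
    (h : F → ℝ) (hdef : ∀ y : F, h y = ∫ x, hhat (y, x) ∂(μ.map X))
    (v : F → ℝ) (vdef : ∀ y : F, v y = ∫ x, (hhat (y, x)) ^ 2 ∂(μ.map X))
    (hint_cc : ∀ j k : Fin d, Integrable
      (fun ω => (hhat (Y ω, X ω) * f (Y ω) j) * (hhat (Y ω, X ω) * f (Y ω) k)) μ)
    (hint_dd : ∀ j k : Fin d, Integrable
      (fun ω => (h (Y ω) * f (Y ω) j) * (h (Y ω) * f (Y ω) k)) μ)
    (hint_rhs : ∀ j k : Fin d, Integrable
      (fun ω => f (Y ω) j * f (Y ω) k * (v (Y ω) - (h (Y ω)) ^ 2)) μ) :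
    ∀ j k : Fin d,
      (∫ ω, (hhat (Y ω, X ω) * f (Y ω) j) * (hhat (Y ω, X ω) * f (Y ω) k) ∂μ)
        - (∫ ω, (h (Y ω) * f (Y ω) j) * (h (Y ω) * f (Y ω) k) ∂μ)
      = ∫ ω, f (Y ω) j * f (Y ω) k * (v (Y ω) - (h (Y ω)) ^ 2) ∂μ := by
  intro j k
  have hcoord (i : Fin d) : Measurable fun p : F × E => f p.1 i := by fun_prop
  have hg : Measurable fun p : F × E => (hhat p * f p.1 j) * (hhat p * f p.1 k) :=
    (hhat_meas.mul (hcoord j)).mul (hhat_meas.mul (hcoord k))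
  rw [sub_eq_iff_eq_add', ← integral_add (hint_dd j k) (hint_rhs j k),
    hindep.integral_comp_prodMk hY hX hg.stronglyMeasurable (hint_cc j k)]
  congr 1 with ω
  calc ∫ x, (hhat (Y ω, x) * f (Y ω) j) * (hhat (Y ω, x) * f (Y ω) k) ∂(μ.map X)
      = ∫ x, (f (Y ω) j * f (Y ω) k) * hhat (Y ω, x) ^ 2 ∂(μ.map X) := by
        congr 1 with x
        ring
    _ = (f (Y ω) j * f (Y ω) k) * v (Y ω) := by rw [integral_const_mul, vdef]
    _ = _ := by ring
end

section
/- Let (Ω, μ) be a probability space, F and E measurable spaces, and Y : Ω → F, X : Ω → E independent random variables. Let f : F → ℝᵈ and ĥ : F × E → ℝ be measurable with all second moments below finite. Define h : F → ℝ by h(y) = E[ĥ(y, X)], and set g_c = ĥ(Y, X)·f(Y) and g_d = h(Y)·f(Y). Then the covariance matrix of g_c dominates that of g_d in the positive semidefinite (Loewner) order: for every vector v ∈ ℝᵈ, Var(⟨v, g_c⟩) ≥ Var(⟨v, g_d⟩), i.e., E[⟨v, g_c⟩²] − (E[⟨v, g_c⟩])² ≥ E[⟨v, g_d⟩²] − (E[⟨v,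 g_d⟩])². -/
open MeasureTheory

open scoped RealInnerProductSpace

/-- Jensen's inequality for the square: averaging out one coordinate of a product probability
space does not increase the second moment. -/
theorem integral_sq_integral_prod_le {F E : Type*} [MeasurableSpace F] [MeasurableSpace E]
    {ν : Measure F} {ρ : Measure E} [SFinite ν] [IsProbabilityMeasure ρ] {k : F × E → ℝ}
    (hk : Integrable k (ν.prod ρ)) (hk2 : Integrable (fun p => k p ^ 2) (ν.prod ρ)) :
    ∫ y, (∫ x, k (y, x) ∂ρ) ^ 2 ∂ν ≤ ∫ p, k p ^ 2 ∂(ν.prod ρ) := by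
  rw [integral_prod _ hk2]
  refine integral_mono_of_nonneg (ae_of_all _ fun y => sq_nonneg _) hk2.integral_prod_left ?_
  filter_upwards [hk.prod_right_ae, hk2.prod_right_ae] with y h1 h2
  exact (even_two.convexOn_pow (𝕜 := ℝ)).map_integral_le (continuous_pow 2).continuousOn
    isClosed_univ (by simp) h1 h2

/-- Theorem 2: the covariance matrix of the centralized (CTDE-DDPG) policy
gradient `g_c = ĥ(Y,X) • f(Y)` dominates that of the decentralized (I-DDPG)
policy gradient `g_d = h(Y) • f(Y)` in the Loewner order: for every `v ∈ ℝᵈ`,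
`Var(⟨v, g_c⟩) ≥ Var(⟨v, g_d⟩)`. -/
theorem variance_centralized_policy_gradient_ge_decentralized
    {Ω F E : Type*} [MeasurableSpace Ω] [MeasurableSpace F] [MeasurableSpace E]
    (μ : Measure Ω) [IsProbabilityMeasure μ]
    (Y : Ω → F) (X : Ω → E) (hY : Measurable Y) (hX : Measurable X)
    (hindep : ProbabilityTheory.IndepFun Y X μ)
    (d : ℕ) (f : F → EuclideanSpace ℝ (Fin d)) (hf : Measurable f)
    (hhat : F × E → ℝ) (hhat_meas : Measurable hhat)
    (hint_x : ∀ y : F, Integrable (fun x => hhat (y, x)) (μ.map X))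
    (hint_x2 : ∀ y : F, Integrable (fun x => (hhat (y, x)) ^ 2) (μ.map X))
    (h : F → ℝ) (hdef : ∀ y : F, h y = ∫ x, hhat (y, x) ∂(μ.map X))
    (v : EuclideanSpace ℝ (Fin d))
    (hint_c1 : Integrable (fun ω => ⟪v, hhat (Y ω, X ω) • f (Y ω)⟫) μ)
    (hint_c2 : Integrable (fun ω => (⟪v, hhat (Y ω, X ω) • f (Y ω)⟫) ^ 2) μ)
    (hint_d1 : Integrable (fun ω => ⟪v, h (Y ω) • f (Y ω)⟫) μ)
    (hint_d2 : Integrable (fun ω => (⟪v, h (Y ω) • f (Y ω)⟫) ^ 2) μ) :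
    (∫ ω, (⟪v, hhat (Y ω, X ω) • f (Y ω)⟫) ^ 2 ∂μ)
        - (∫ ω, ⟪v, hhat (Y ω, X ω) • f (Y ω)⟫ ∂μ) ^ 2
      ≥ (∫ ω, (⟪v, h (Y ω) • f (Y ω)⟫) ^ 2 ∂μ)
        - (∫ ω, ⟪v, h (Y ω) • f (Y ω)⟫ ∂μ) ^ 2 := by
  have hYX : Measurable fun ω => (Y ω, X ω) := hY.prodMk hX
  have hmap : μ.map (fun ω => (Y ω, X ω)) = (μ.map Y).prod (μ.map X) :=
    (ProbabilityTheory.indepFun_iff_map_prod_eq_prod_map_map hY.aemeasurable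
      hX.aemeasurable).1 hindep
  have : IsProbabilityMeasure (μ.map X) := Measure.isProbabilityMeasure_map hX.aemeasurable
  have : IsProbabilityMeasure (μ.map Y) := Measure.isProbabilityMeasure_map hY.aemeasurable
  let k : F × E → ℝ := fun p => ⟪v, hhat p • f p.1⟫
  have hk_meas : Measurable k :=
    measurable_const.inner (hhat_meas.smul (hf.comp measurable_fst))
  have hk : Integrable k ((μ.map Y).prod (μ.map X)) := by
    rw [← hmap, integrable_map_measure hk_meas.aestronglyMeasurable hYX.aemeasurable]
    exact hint_c1
  have hk2 : Integrable (fun p => k p ^ 2) ((μ.map Y).prod (μ.map X)) := by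
    rw [← hmap, integrable_map_measure (hk_meas.pow_const 2).aestronglyMeasurable
      hYX.aemeasurable]
    exact hint_c2
  have hh (y : F) : ∫ x, k (y, x) ∂(μ.map X) = ⟪v, h y • f y⟫ := by
    simp only [k, real_inner_smul_right, integral_mul_const, hdef]
  have hd_meas : StronglyMeasurable fun y => ⟪v, h y • f y⟫ := by
    simp only [← hh]
    exact hk_meas.stronglyMeasurable.integral_prod_right'
  have hmean : ∫ ω, ⟪v, hhat (Y ω, X ω) • f (Y ω)⟫ ∂μ = ∫ ω, ⟪v, h (Y ω) • f (Y ω)⟫ ∂μ := by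
    have hc := integral_map (μ := μ) hYX.aemeasurable (f := k) hk_meas.aestronglyMeasurable
    have hd := integral_map (μ := μ) hY.aemeasurable hd_meas.aestronglyMeasurable
    rw [hmap, integral_prod _ hk] at hc
    simp only [hh] at hc
    exact hc.symm.trans hd
  have hc2 := integral_map (μ := μ) hYX.aemeasurable (f := fun p => k p ^ 2)
    (hk_meas.pow_const 2).aestronglyMeasurable
  have hd2 := integral_map (μ := μ) hY.aemeasurable (hd_meas.pow 2).aestronglyMeasurable
  have hjensen := integral_sq_integral_prod_le hk hk2
  simp only [hh] at hjensen
  rw [hmean]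
  refine sub_le_sub_right ?_ _
  calc ∫ ω, ⟪v, h (Y ω) • f (Y ω)⟫ ^ 2 ∂μ
      = ∫ y, ⟪v, h y • f y⟫ ^ 2 ∂(μ.map Y) := hd2.symm
    _ ≤ ∫ p, k p ^ 2 ∂((μ.map Y).prod (μ.map X)) := hjensen
    _ = ∫ ω, ⟪v, hhat (Y ω, X ω) • f (Y ω)⟫ ^ 2 ∂μ := by rw [← hmap]; exact hc2
end

section
/- Let (Ω, μ) be a probability space, F and E measurable spaces, and Y : Ω → F, X : Ω → E independent random variables. Let f : F → ℝᵈ and ĥ : F × E → ℝ be measurable with all second moments below finite, and suppose there is a constant B ≥ 0 with ‖f(y)‖² ≤ B for all y ∈ F. Define h : F → ℝ by h(y) = E[ĥ(y, X)] and the pointwise conditional variance V : F → ℝ by V(y) = E[ĥ(y, X)²] − h(y)². Set g_c = ĥ(Y, X)·f(Y) and g_d = h(Y)·f(Y). Then the difference of the traces of the covariance matrices satisfies Σ_{j=1}^{d} ( Var((g_c)_j) − Var((g_d)_j) ) = E[ ‖f(Y)‖² · V(Y) ] ≤ B · E[ V(Y) ]. -/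
open MeasureTheory

namespace ProbabilityTheory

variable {Ω F E : Type*} [MeasurableSpace Ω] [MeasurableSpace F] [MeasurableSpace E]
  {μ : Measure Ω} [IsProbabilityMeasure μ] {Y : Ω → F} {X : Ω → E} {G : F × E → ℝ}

lemma IndepFun.integrable_prod_map (hindep : IndepFun Y X μ) (hY : Measurable Y)
    (hX : Measurable X) (hG : Measurable G) (hint : Integrable (fun ω => G (Y ω, X ω)) μ) :
    Integrable G ((μ.map Y).prod (μ.map X)) := by
  rw [← (indepFun_iff_map_prod_eq_prod_map_map hY.aemeasurable hX.aemeasurable).1 hindep]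
  exact (integrable_map_measure hG.aestronglyMeasurable (hY.prodMk hX).aemeasurable).2 hint

lemma IndepFun.integrable_integral_right (hindep : IndepFun Y X μ) (hY : Measurable Y)
    (hX : Measurable X) (hG : Measurable G) (hint : Integrable (fun ω => G (Y ω, X ω)) μ) :
    Integrable (fun ω => ∫ x, G (Y ω, x) ∂(μ.map X)) μ := by
  have := Measure.isProbabilityMeasure_map (μ := μ) hX.aemeasurable
  exact (hindep.integrable_prod_map hY hX hG hint).integral_prod_left.comp_measurable hY

lemma IndepFun.integral_comp_prodMk_s4 (hindep : IndepFun Y X μ) (hY : Measurable Y)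
    (hX : Measurable X) (hG : Measurable G) (hint : Integrable (fun ω => G (Y ω, X ω)) μ) :
    ∫ ω, G (Y ω, X ω) ∂μ = ∫ ω, ∫ x, G (Y ω, x) ∂(μ.map X) ∂μ := by
  have := Measure.isProbabilityMeasure_map (μ := μ) hX.aemeasurable
  have := Measure.isProbabilityMeasure_map (μ := μ) hY.aemeasurable
  have hprod := hindep.integrable_prod_map hY hX hG hint
  rw [← integral_map (hY.prodMk hX).aemeasurable hG.aestronglyMeasurable,
    (indepFun_iff_map_prod_eq_prod_map_map hY.aemeasurable hX.aemeasurable).1 hindep,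
    integral_prod _ hprod,
    integral_map hY.aemeasurable hprod.integral_prod_left.aestronglyMeasurable]

end ProbabilityTheory

/-- The quantitative bound concluding the proof of Theorem 2: the difference of
the traces of the covariance matrices of the centralized policy gradient
`g_c = ĥ(Y,X) • f(Y)` and the decentralized policy gradient `g_d = h(Y) • f(Y)`
equals `E[‖f(Y)‖² V(Y)]` and is bounded by `B · E[V(Y)]`, where
`V(y) = E[ĥ(y,X)²] − h(y)²` is the conditional variance and
`‖f(y)‖² ≤ B` uniformly. -/
theorem trace_variance_difference_eq_and_le_bound
    {Ω F E : Type*} [MeasurableSpace Ω] [MeasurableSpace F] [MeasurableSpace E]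
    (μ : Measure Ω) [IsProbabilityMeasure μ]
    (Y : Ω → F) (X : Ω → E) (hY : Measurable Y) (hX : Measurable X)
    (hindep : ProbabilityTheory.IndepFun Y X μ)
    (d : ℕ) (f : F → EuclideanSpace ℝ (Fin d)) (hf : Measurable f)
    (hhat : F × E → ℝ) (hhat_meas : Measurable hhat)
    (B : ℝ) (hB : 0 ≤ B) (hfB : ∀ y : F, ‖f y‖ ^ 2 ≤ B)
    (hint_x : ∀ y : F, Integrable (fun x => hhat (y, x)) (μ.map X))
    (hint_x2 : ∀ y : F, Integrable (fun x => (hhat (y, x)) ^ 2) (μ.map X))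
    (h : F → ℝ) (hdef : ∀ y : F, h y = ∫ x, hhat (y, x) ∂(μ.map X))
    (V : F → ℝ)
    (Vdef : ∀ y : F, V y = (∫ x, (hhat (y, x)) ^ 2 ∂(μ.map X)) - (h y) ^ 2)
    (hint_c1 : ∀ j : Fin d, Integrable (fun ω => hhat (Y ω, X ω) * f (Y ω) j) μ)
    (hint_c2 : ∀ j : Fin d,
      Integrable (fun ω => (hhat (Y ω, X ω) * f (Y ω) j) ^ 2) μ)
    (hint_d1 : ∀ j : Fin d, Integrable (fun ω => h (Y ω) * f (Y ω) j) μ)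
    (hint_d2 : ∀ j : Fin d, Integrable (fun ω => (h (Y ω) * f (Y ω) j) ^ 2) μ)
    (hint_fV : Integrable (fun ω => ‖f (Y ω)‖ ^ 2 * V (Y ω)) μ)
    (hint_V : Integrable (fun ω => V (Y ω)) μ) :
    (∑ j : Fin d,
        (((∫ ω, (hhat (Y ω, X ω) * f (Y ω) j) ^ 2 ∂μ)
            - (∫ ω, hhat (Y ω, X ω) * f (Y ω) j ∂μ) ^ 2)
          - ((∫ ω, (h (Y ω) * f (Y ω) j) ^ 2 ∂μ)
            - (∫ ω, h (Y ω) * f (Y ω) j ∂μ) ^ 2)))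
      = ∫ ω, ‖f (Y ω)‖ ^ 2 * V (Y ω) ∂μ
    ∧ (∫ ω, ‖f (Y ω)‖ ^ 2 * V (Y ω) ∂μ) ≤ B * ∫ ω, V (Y ω) ∂μ := by
  have := Measure.isProbabilityMeasure_map (μ := μ) hX.aemeasurable
  have hfj : ∀ j : Fin d, Measurable fun y => f y j := fun j => by fun_prop
  have hV : ∀ y, 0 ≤ V y := fun y => by
    have hL : MemLp (fun x => hhat (y, x)) 2 (μ.map X) :=
      (memLp_two_iff_integrable_sq (hint_x y).aestronglyMeasurable).2 (hint_x2 y)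
    have hvar := ProbabilityTheory.variance_nonneg (fun x => hhat (y, x)) (μ.map X)
    rw [ProbabilityTheory.variance_eq_sub hL] at hvar
    simpa [Vdef, hdef] using hvar
  refine ⟨?_, ?_⟩
  · have hmean : ∀ j, ∫ ω, hhat (Y ω, X ω) * f (Y ω) j ∂μ = ∫ ω, h (Y ω) * f (Y ω) j ∂μ := by
      intro j
      rw [hindep.integral_comp_prodMk_s4 (G := fun p => hhat p * f p.1 j) hY hX
        (hhat_meas.mul ((hfj j).comp measurable_fst)) (hint_c1 j)]
      simp only [integral_mul_const, hdef]
    have hG : ∀ j, Measurable fun p : F × E => (hhat p * f p.1 j) ^ 2 := fun j =>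
      (hhat_meas.mul ((hfj j).comp measurable_fst)).pow_const 2
    have hpt : ∀ j ω, ∫ x, (hhat (Y ω, x) * f (Y ω) j) ^ 2 ∂(μ.map X)
        - (h (Y ω) * f (Y ω) j) ^ 2 = f (Y ω) j ^ 2 * V (Y ω) := by
      intro j ω
      simp only [mul_pow, integral_mul_const, Vdef]
      ring
    have hI : ∀ j, Integrable (fun ω => f (Y ω) j ^ 2 * V (Y ω)) μ := fun j => by
      simp only [← hpt]
      exact (hindep.integrable_integral_right hY hX (hG j) (hint_c2 j)).sub (hint_d2 j)
    have hterm : ∀ j, ∫ ω, (hhat (Y ω, X ω) * f (Y ω) j) ^ 2 ∂μ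
        - ∫ ω, (h (Y ω) * f (Y ω) j) ^ 2 ∂μ = ∫ ω, f (Y ω) j ^ 2 * V (Y ω) ∂μ := by
      intro j
      rw [hindep.integral_comp_prodMk_s4 hY hX (hG j) (hint_c2 j), ← integral_sub
        (hindep.integrable_integral_right hY hX (hG j) (hint_c2 j)) (hint_d2 j)]
      simp only [hpt]
    simp only [hmean, sub_sub_sub_cancel_right, hterm]
    rw [← integral_finsetSum _ fun j _ => hI j]
    simp only [EuclideanSpace.real_norm_sq_eq, Finset.sum_mul]
  · rw [← integral_const_mul]
    exact integral_mono hint_fV (hint_V.const_mul B) fun ω =>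
      mul_le_mul_of_nonneg_right (hfB (Y ω)) (hV (Y ω))
end
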